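/- arXiv:2307.05400 — 4 statements merged into one kernel-verified Lean document; each statement's English description precedes it below -/
import Mathlib

section
/- The vectorial distance satisfies the triangle inequality with respect to the majorization order: d⃗(p,q) ⪯ d⃗(p,r) + d⃗(r,q) for all p, q, r ∈ S⁺_d. -/
open Matrix Polynomial

/-- The singular values of a square real matrix `A`, i.e. the square roots of the
eigenvalues of `Aᵀ * A`, arranged in non-increasing order:
`singularValues A 0 = α_1 ≥ singularValues A 1 = α_2 ≥ ⋯`. -/
noncomputable def singularValues {d : ℕ} (A : Matrix (Fin d) (Fin d) ℝ) : Fin d → ℝ :=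
  fun i =>
    let g : Fin d → ℝ := fun j => Real.sqrt ((Matrix.isHermitian_conjTranspose_mul_self A).eigenvalues j)
    g (Tuple.sort g i.rev)

/-- `logSV A = σ⃗(A) = (log α_1(A), …, log α_d(A))`. -/
noncomputable def logSV {d : ℕ} (A : Matrix (Fin d) (Fin d) ℝ) : Fin d → ℝ :=
  fun i => Real.log (singularValues A i)

/-- Spectral power of a symmetric matrix: `mpow p t = p^t` via the spectral theorem
(junk value `p` if `p` is not Hermitian). -/
noncomputable def mpow {d : ℕ} (p : Matrix (Fin d) (Fin d) ℝ) (t : ℝ) :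
    Matrix (Fin d) (Fin d) ℝ :=
  if h : p.IsHermitian then
    (h.eigenvectorUnitary : Matrix (Fin d) (Fin d) ℝ) *
      Matrix.diagonal (fun i => (h.eigenvalues i) ^ t) *
      star (h.eigenvectorUnitary : Matrix (Fin d) (Fin d) ℝ)
  else p

/-- Spectral logarithm of a symmetric positive definite matrix (junk value `p` if `p`
is not Hermitian). -/
noncomputable def mlog {d : ℕ} (p : Matrix (Fin d) (Fin d) ℝ) :
    Matrix (Fin d) (Fin d) ℝ :=
  if h : p.IsHermitian then
    (h.eigenvectorUnitary : Matrix (Fin d) (Fin d) ℝ) *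
      Matrix.diagonal (fun i => Real.log (h.eigenvalues i)) *
      star (h.eigenvectorUnitary : Matrix (Fin d) (Fin d) ℝ)
  else p

/-- The matrix exponential `exp(A) = ∑ Aⁿ/n!`. -/
noncomputable def mexp {d : ℕ} (A : Matrix (Fin d) (Fin d) ℝ) : Matrix (Fin d) (Fin d) ℝ :=
  ∑' n : ℕ, ((n.factorial : ℝ)⁻¹) • A ^ n

/-- The geodesic `p #_t q := p^{1/2} (p^{-1/2} q p^{-1/2})^t p^{1/2}` on `S⁺_d`,
where `p^{-1/2} = (p^{1/2})⁻¹`. -/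
noncomputable def geo {d : ℕ} (p q : Matrix (Fin d) (Fin d) ℝ) (t : ℝ) :
    Matrix (Fin d) (Fin d) ℝ :=
  mpow p (1/2) * mpow ((mpow p (1/2))⁻¹ * q * (mpow p (1/2))⁻¹) t * mpow p (1/2)

/-- The vectorial distance `d⃗(p,q) := 2 σ⃗(p^{-1/2} q^{1/2})` on `S⁺_d`. -/
noncomputable def vecd {d : ℕ} (p q : Matrix (Fin d) (Fin d) ℝ) : Fin d → ℝ :=
  fun i => 2 * Real.log (singularValues ((mpow p (1/2))⁻¹ * mpow q (1/2)) i)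

/-- The majorization order on `ℝ^d`: all partial sums of `x` are dominated by those of `y`
and the total sums agree. -/
def Majorizes {d : ℕ} (x y : Fin d → ℝ) : Prop :=
  (∀ k : ℕ, k < d →
    ∑ i ∈ Finset.univ.filter (fun i : Fin d => (i : ℕ) < k), x i ≤
      ∑ i ∈ Finset.univ.filter (fun i : Fin d => (i : ℕ) < k), y i) ∧
  ∑ i, x i = ∑ i, y i

/-- The weak majorization order on `ℝ^d`: all partial sums of `x` are dominated by those
of `y`. -/
def WeakMajorizes {d : ℕ} (x y : Fin d → ℝ) : Prop :=
  ∀ k : ℕ, k ≤ d →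
    ∑ i ∈ Finset.univ.filter (fun i : Fin d => (i : ℕ) < k), x i ≤
      ∑ i ∈ Finset.univ.filter (fun i : Fin d => (i : ℕ) < k), y i

lemma aux_expand {k d : ℕ} (P : Matrix (Fin k) (Fin d) ℝ) (Q : Matrix (Fin d) (Fin k) ℝ) :
    (P * Q).det = ∑ f : Fin k → Fin d, (∏ i, P i (f i)) * (Q.submatrix f id).det := by
  have h1 : P * Q = fun i => ∑ j, P i j • Q j := by
    ext i l
    simp [Matrix.mul_apply, Finset.sum_apply]
  have h2 := (Matrix.detRowAlternating (R := ℝ) (n := Fin k)).toMultilinearMap.map_sum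
    (fun i (j : Fin d) => P i j • Q j)
  have h3 : (P * Q).det = ∑ f : Fin k → Fin d,
      Matrix.detRowAlternating (R := ℝ) (fun i => P i (f i) • Q (f i)) := by
    rw [h1]; exact h2
  rw [h3]
  refine Finset.sum_congr rfl fun f _ => ?_
  have := (Matrix.detRowAlternating (R := ℝ) (n := Fin k)).toMultilinearMap.map_smul_univ
    (fun i => P i (f i)) (fun i => Q (f i))
  exact this

lemma aux_cb {k d : ℕ} (D : Fin d → ℝ) (W : Matrix (Fin d) (Fin k) ℝ) :
    (Nat.factorial k : ℝ) * (Wᵀ * diagonal D * W).det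
      = ∑ f : Fin k → Fin d, (∏ i, D (f i)) * (W.submatrix f id).det ^ 2 := by
  have h0 : (Wᵀ * diagonal D * W).det =
      ∑ f : Fin k → Fin d, (∏ i, D (f i)) * ((∏ i, W (f i) i) * (W.submatrix f id).det) := by
    rw [aux_expand]
    refine Finset.sum_congr rfl fun f _ => ?_
    simp only [Matrix.mul_diagonal, Matrix.transpose_apply, Finset.prod_mul_distrib]
    ring
  have h1 : ∀ σ : Equiv.Perm (Fin k), (Wᵀ * diagonal D * W).det =
      ∑ f : Fin k → Fin d, (∏ i, D (f i)) *
        (((Equiv.Perm.sign σ : ℤ) : ℝ) * (∏ i, W (f (σ i)) i) * (W.submatrix f id).det) := by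
    intro σ
    rw [h0, ← Equiv.sum_comp (Equiv.arrowCongr σ.symm (Equiv.refl (Fin d)))]
    refine Finset.sum_congr rfl fun f _ => ?_
    have e1 : ∏ i, D (f (σ i)) = ∏ i, D (f i) := Equiv.prod_comp σ (fun i => D (f i))
    have e2 : (W.submatrix (fun i => f (σ i)) id).det
        = ((Equiv.Perm.sign σ : ℤ) : ℝ) * (W.submatrix f id).det := by
      exact Matrix.det_permute σ (W.submatrix f id)
    simp only [Equiv.arrowCongr_apply, Equiv.symm_symm, Equiv.coe_refl, Function.comp_def, id]
    rw [e1]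
    erw [e2]
    ring
  have h2 : ∑ σ : Equiv.Perm (Fin k), (Wᵀ * diagonal D * W).det
      = (Nat.factorial k : ℝ) * (Wᵀ * diagonal D * W).det := by
    simp [Fintype.card_perm]
  rw [← h2, Finset.sum_congr rfl fun σ _ => h1 σ, Finset.sum_comm]
  refine Finset.sum_congr rfl fun f _ => ?_
  rw [← Finset.mul_sum, ← Finset.sum_mul, sq]
  congr 2
  rw [Matrix.det_apply']
  rfl

lemma aux_prod {k d : ℕ} (hk : k ≤ d) (D : Fin d → ℝ) (hD : Antitone D) (h0 : ∀ i, 0 ≤ D i)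
    (f : Fin k → Fin d) (hf : Function.Injective f) :
    ∏ i, D (f i) ≤ ∏ i : Fin k, D (Fin.castLE hk i) := by
  classical
  have hc : (Finset.univ.image f).card = k := by
    rw [Finset.card_image_of_injective _ hf]; simp
  have h1 : ∏ i, D (f i) = ∏ j ∈ Finset.univ.image f, D j := by
    rw [Finset.prod_image]; intro a _ b _ h; exact hf h
  have h2 : ∏ j ∈ Finset.univ.image f, D j
      = ∏ i : Fin k, D ((Finset.univ.image f).orderEmbOfFin hc i) := by
    conv_lhs => rw [← Finset.image_orderEmbOfFin_univ _ hc]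
    rw [Finset.prod_image]
    intro a _ b _ h; exact ((Finset.univ.image f).orderEmbOfFin hc).injective h
  rw [h1, h2]
  refine Finset.prod_le_prod (fun i _ => h0 _) fun i _ => hD ?_
  have hs : StrictMono ((Finset.univ.image f).orderEmbOfFin hc) := OrderEmbedding.strictMono _
  generalize (Finset.univ.image f).orderEmbOfFin hc = g at hs
  have : ∀ n (hn : n < k), n ≤ (g ⟨n, hn⟩ : ℕ) := by
    intro n
    induction n with
    | zero => intro _; omega
    | succ n ih =>
      intro hn
      have a := ih (by omega)
      have b : g ⟨n, by omega⟩ < g ⟨n+1, hn⟩ := hs (by simp)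
      have b' : (g ⟨n, by omega⟩ : ℕ) < g ⟨n+1, hn⟩ := b
      omega
  exact this i i.2

lemma aux_sv {d : ℕ} (A : Matrix (Fin d) (Fin d) ℝ) :
    Antitone (singularValues A) ∧ (∀ i, 0 ≤ singularValues A i) ∧
    ∃ U : Matrix (Fin d) (Fin d) ℝ, Uᵀ * U = 1 ∧ U * Uᵀ = 1 ∧
      Aᵀ * A = U * diagonal (fun i => singularValues A i ^ 2) * Uᵀ := by
  refine ⟨?_, fun i => Real.sqrt_nonneg _, ?_⟩
  · intro i j hij
    exact Tuple.monotone_sort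
      (fun j => Real.sqrt ((Matrix.isHermitian_conjTranspose_mul_self A).eigenvalues j))
      (Fin.rev_le_rev.2 hij)
  · set h := Matrix.isHermitian_conjTranspose_mul_self A with hh
    set g : Fin d → ℝ := fun j => Real.sqrt (h.eigenvalues j) with hg
    let e : Fin d ≃ Fin d := Fin.revPerm.trans (Tuple.sort g)
    let V : Matrix (Fin d) (Fin d) ℝ := h.eigenvectorUnitary
    have hV1 : Vᵀ * V = 1 := by
      have := (Matrix.mem_unitaryGroup_iff').1 h.eigenvectorUnitary.2
      simpa [Matrix.star_eq_conjTranspose, V] using this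
    have hV2 : V * Vᵀ = 1 := mul_eq_one_comm.1 hV1
    have hs : ∀ i, singularValues A i ^ 2 = h.eigenvalues (e i) := by
      intro i
      exact Real.sq_sqrt ((Matrix.posSemidef_conjTranspose_mul_self A).eigenvalues_nonneg _)
    have hspec : Aᵀ * A = V * diagonal h.eigenvalues * Vᵀ := by
      have := h.spectral_theorem
      simpa [Unitary.conjStarAlgAut_apply, Matrix.star_eq_conjTranspose, V, Function.comp_def] using this
    refine ⟨V.submatrix id e, ?_, ?_, ?_⟩
    · rw [Matrix.transpose_submatrix, Matrix.submatrix_mul _ _ _ id _ Function.bijective_id |>.symm, hV1]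
      simp
    · rw [Matrix.transpose_submatrix, Matrix.submatrix_mul _ _ _ e _ e.bijective |>.symm, hV2]
      simp
    · have : diagonal (fun i => singularValues A i ^ 2) = (diagonal h.eigenvalues).submatrix e e := by
        simp [Matrix.submatrix_diagonal_equiv, hs, Function.comp_def]
      rw [this, Matrix.transpose_submatrix, (Matrix.submatrix_mul _ _ _ e _ e.bijective).symm,
        (Matrix.submatrix_mul _ _ _ e _ e.bijective).symm, hspec]
      simp

lemma aux_le {k d : ℕ} (hk : k ≤ d) (A : Matrix (Fin d) (Fin d) ℝ)
    (V : Matrix (Fin d) (Fin k) ℝ) :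
    ((A * V)ᵀ * (A * V)).det ≤
      (∏ i : Fin k, singularValues A (Fin.castLE hk i) ^ 2) * (Vᵀ * V).det := by
  obtain ⟨ha, h0, U, hU1, hU2, hU⟩ := aux_sv A
  have e1 : (A * V)ᵀ * (A * V) = (Uᵀ * V)ᵀ * diagonal (fun i => singularValues A i ^ 2) * (Uᵀ * V) := by
    calc (A * V)ᵀ * (A * V) = Vᵀ * (Aᵀ * A) * V := by
          simp only [Matrix.transpose_mul, Matrix.mul_assoc]
      _ = _ := by
          rw [hU]; simp only [Matrix.transpose_mul, Matrix.mul_assoc, Matrix.transpose_transpose]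
  have e2 : Vᵀ * V = (Uᵀ * V)ᵀ * (diagonal (fun _ => (1:ℝ)) : Matrix (Fin d) (Fin d) ℝ) * (Uᵀ * V) := by
    calc Vᵀ * V = Vᵀ * (U * Uᵀ) * V := by rw [hU2]; simp
      _ = _ := by rw [Matrix.diagonal_one, Matrix.mul_one]; simp only [Matrix.transpose_mul, Matrix.mul_assoc, Matrix.transpose_transpose]
  have hpos : (0:ℝ) < Nat.factorial k := by exact_mod_cast Nat.factorial_pos k
  refine le_of_mul_le_mul_left ?_ hpos
  rw [mul_left_comm, e1, e2, aux_cb, aux_cb, Finset.mul_sum]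
  refine Finset.sum_le_sum fun f _ => ?_
  by_cases hf : Function.Injective f
  · simp only [Finset.prod_const_one, one_mul]
    refine mul_le_mul_of_nonneg_right ?_ (sq_nonneg _)
    exact aux_prod hk (fun i => singularValues A i ^ 2)
      (fun i j hij => pow_le_pow_left₀ (h0 _) (ha hij) 2) (fun i => sq_nonneg _) f hf
  · have : ((Uᵀ * V).submatrix f id).det = 0 := by
      simp only [Function.Injective, not_forall] at hf
      obtain ⟨a, b, hab, hne⟩ := hf
      refine Matrix.det_zero_of_row_eq hne ?_
      ext j; simp [hab]
    simp [this]

lemma aux_horn {k d : ℕ} (hk : k ≤ d) (A B : Matrix (Fin d) (Fin d) ℝ) :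
    ∏ i : Fin k, singularValues (A * B) (Fin.castLE hk i) ^ 2 ≤
      (∏ i : Fin k, singularValues A (Fin.castLE hk i) ^ 2) *
      ∏ i : Fin k, singularValues B (Fin.castLE hk i) ^ 2 := by
  obtain ⟨ha, h0, U, hU1, hU2, hU⟩ := aux_sv (A * B)
  let c : Fin k → Fin d := Fin.castLE hk
  have hc : Function.Injective c := Fin.castLE_injective hk
  let V : Matrix (Fin d) (Fin k) ℝ := U.submatrix id c
  have hV : Vᵀ * V = 1 := by
    have : Vᵀ * V = (Uᵀ * U).submatrix c c := by ext i j; simp [V, Matrix.mul_apply]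
    rw [this, hU1, Matrix.submatrix_one _ hc]
  have hABV : (A * (B * V))ᵀ * (A * (B * V)) =
      diagonal (fun i => singularValues (A * B) (c i) ^ 2) := by
    have h1 : (A * (B * V))ᵀ * (A * (B * V)) = (Uᵀ * ((A * B)ᵀ * (A * B)) * U).submatrix c c := by
      have : A * (B * V) = ((A * B) * U).submatrix id c := by
        rw [← Matrix.mul_assoc]; ext i j; simp [V, Matrix.mul_apply]
      rw [this]
      have : Uᵀ * ((A * B)ᵀ * (A * B)) * U = ((A * B) * U)ᵀ * ((A * B) * U) := by
        simp only [Matrix.transpose_mul, Matrix.mul_assoc]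
      rw [this]
      ext i j; simp [Matrix.mul_apply]
    have h2 : Uᵀ * ((A * B)ᵀ * (A * B)) * U = diagonal (fun i => singularValues (A * B) i ^ 2) := by
      rw [hU]
      calc _ = (Uᵀ * U) * diagonal (fun i => singularValues (A * B) i ^ 2) * (Uᵀ * U) := by
            simp only [Matrix.mul_assoc]
        _ = _ := by rw [hU1]; simp
    rw [h1, h2, Matrix.submatrix_diagonal _ _ hc]
    rfl
  have l1 := aux_le hk A (B * V)
  have l2 := aux_le hk B V
  rw [hABV, Matrix.det_diagonal] at l1
  rw [hV, Matrix.det_one, mul_one] at l2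
  exact l1.trans (mul_le_mul_of_nonneg_left l2 (Finset.prod_nonneg fun i _ => sq_nonneg _))

lemma aux_det {d : ℕ} (A : Matrix (Fin d) (Fin d) ℝ) :
    ∏ i, singularValues A i ^ 2 = A.det ^ 2 := by
  obtain ⟨ha, h0, U, hU1, hU2, hU⟩ := aux_sv A
  have h := congrArg Matrix.det hU
  have h' := congrArg Matrix.det hU1
  simp only [Matrix.det_mul, Matrix.det_transpose, Matrix.det_diagonal, Matrix.det_one] at h h'
  rw [sq A.det, h]
  linear_combination (-∏ i, singularValues A i ^ 2) * h'

lemma aux_pos {d : ℕ} (A : Matrix (Fin d) (Fin d) ℝ) (hA : A.det ≠ 0) (i : Fin d) :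
    0 < singularValues A i ^ 2 := by
  have h := aux_det A
  have : ∏ i, singularValues A i ^ 2 ≠ 0 := by rw [h]; exact pow_ne_zero 2 hA
  have := Finset.prod_ne_zero_iff.1 this i (Finset.mem_univ i)
  exact lt_of_le_of_ne (sq_nonneg _) this.symm

lemma aux_mpow {d : ℕ} (p : Matrix (Fin d) (Fin d) ℝ) (hp : p.PosDef) (t : ℝ) :
    (mpow p t).det ≠ 0 := by
  unfold mpow
  rw [dif_pos hp.1]
  have hV := (Matrix.mem_unitaryGroup_iff).1 hp.1.eigenvectorUnitary.2
  have h' := congrArg Matrix.det hV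
  rw [Matrix.det_mul, Matrix.det_one] at h'
  rw [Matrix.det_mul, Matrix.det_mul, Matrix.det_diagonal]
  have hp0 : ∏ i, hp.1.eigenvalues i ^ t ≠ 0 :=
    Finset.prod_ne_zero_iff.2 fun i _ => (Real.rpow_pos_of_pos (hp.eigenvalues_pos i) t).ne'
  exact mul_ne_zero (mul_ne_zero (left_ne_zero_of_mul_eq_one h') hp0)
    (right_ne_zero_of_mul_eq_one h')

lemma aux_sum {k d : ℕ} (hk : k ≤ d) (F : Fin d → ℝ) :
    ∑ i ∈ Finset.univ.filter (fun i : Fin d => (i : ℕ) < k), F i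
      = ∑ i : Fin k, F (Fin.castLE hk i) := by
  symm
  refine Finset.sum_bij (fun i _ => Fin.castLE hk i) ?_ ?_ ?_ ?_
  · intro i _; simp
  · intro a _ b _ h; exact Fin.castLE_injective hk h
  · intro b hb
    exact ⟨⟨b, (Finset.mem_filter.1 hb).2⟩, Finset.mem_univ _, rfl⟩
  · intros; rfl

lemma aux_log {k d : ℕ} (hk : k ≤ d) (A : Matrix (Fin d) (Fin d) ℝ) (hA : A.det ≠ 0) :
    ∑ i : Fin k, 2 * Real.log (singularValues A (Fin.castLE hk i)) =
      Real.log (∏ i : Fin k, singularValues A (Fin.castLE hk i) ^ 2) := by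
  rw [Real.log_prod (fun i _ => (aux_pos A hA _).ne')]
  simp [Real.log_pow]

/-- The vectorial distance satisfies the triangle inequality with respect
to the majorization order: `d⃗(p,q) ⪯ d⃗(p,r) + d⃗(r,q)` for all `p, q, r ∈ S⁺_d`. -/
theorem stmt_2 {d : ℕ} (hd : 1 ≤ d) (p q r : Matrix (Fin d) (Fin d) ℝ)
    (hp : p.PosDef) (hq : q.PosDef) (hr : r.PosDef) :
    Majorizes (vecd p q) (fun i => vecd p r i + vecd r q i) := by
  have dp := aux_mpow p hp (1/2)
  have dq := aux_mpow q hq (1/2)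
  have dr := aux_mpow r hr (1/2)
  have hAB : (mpow p (1/2))⁻¹ * mpow q (1/2) =
      ((mpow p (1/2))⁻¹ * mpow r (1/2)) * ((mpow r (1/2))⁻¹ * mpow q (1/2)) := by
    rw [Matrix.mul_assoc, Matrix.mul_nonsing_inv_cancel_left _ _ (isUnit_iff_ne_zero.2 dr)]
  have inv0 : ∀ M : Matrix (Fin d) (Fin d) ℝ, M.det ≠ 0 → M⁻¹.det ≠ 0 := by
    intro M hM
    rw [Matrix.det_nonsing_inv, Ring.inverse_eq_inv']
    exact inv_ne_zero hM
  unfold vecd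
  rw [hAB]
  have hA : ((mpow p (1/2))⁻¹ * mpow r (1/2)).det ≠ 0 := by
    rw [Matrix.det_mul]; exact mul_ne_zero (inv0 _ dp) dr
  have hB : ((mpow r (1/2))⁻¹ * mpow q (1/2)).det ≠ 0 := by
    rw [Matrix.det_mul]; exact mul_ne_zero (inv0 _ dr) dq
  generalize (mpow p (1/2))⁻¹ * mpow r (1/2) = A at hA
  generalize (mpow r (1/2))⁻¹ * mpow q (1/2) = B at hB
  have hC : (A * B).det ≠ 0 := by rw [Matrix.det_mul]; exact mul_ne_zero hA hB
  have pp : ∀ {k : ℕ} (hk : k ≤ d) (M : Matrix (Fin d) (Fin d) ℝ), M.det ≠ 0 →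
      0 < ∏ i : Fin k, singularValues M (Fin.castLE hk i) ^ 2 :=
    fun hk M hM => Finset.prod_pos fun i _ => aux_pos M hM _
  refine ⟨fun k hk => ?_, ?_⟩
  · rw [aux_sum hk.le, aux_sum hk.le, Finset.sum_add_distrib, aux_log hk.le _ hA,
      aux_log hk.le _ hB, aux_log hk.le _ hC,
      ← Real.log_mul (pp hk.le A hA).ne' (pp hk.le B hB).ne']
    exact Real.log_le_log (pp hk.le _ hC) (aux_horn hk.le A B)
  · have key : ∀ M : Matrix (Fin d) (Fin d) ℝ, M.det ≠ 0 →
        ∑ i, 2 * Real.log (singularValues M i) = Real.log (M.det ^ 2) := by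
      intro M hM
      rw [← aux_det]
      exact aux_log le_rfl M hM
    rw [Finset.sum_add_distrib, key _ hA, key _ hB, key _ hC, Matrix.det_mul, mul_pow,
      Real.log_mul (pow_ne_zero 2 hA) (pow_ne_zero 2 hB)]
end

section
/- Let p, q ∈ S⁺_d and define h := p^{1/2} log(p^{−1/2} q p^{−1/2}) p^{1/2}, where log denotes the spectral (matrix) logarithm of a symmetric positive definite matrix. Then: (a) h is symmetric; (b) p #_t q = p · exp(t p^{−1} h) for all t ∈ [0,1]; (c) h is the unique symmetric d×d matrix h′ satisfying p · exp(p^{−1} h′) = q. -/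
open Matrix Polynomial

lemma mexp_eq {d : ℕ} (A : Matrix (Fin d) (Fin d) ℝ) : mexp A = NormedSpace.exp A := by
  rw [NormedSpace.exp_eq_tsum ℝ]; rfl

lemma mlog_symm {d : ℕ} {M : Matrix (Fin d) (Fin d) ℝ} (hM : M.PosDef) : (mlog M)ᵀ = mlog M := by
  rw [mlog, dif_pos hM.1, star_eq_conjTranspose, conjTranspose_eq_transpose_of_trivial]
  simp [Matrix.transpose_mul, Matrix.mul_assoc]

lemma mpow_eq {d : ℕ} {M : Matrix (Fin d) (Fin d) ℝ} (hM : M.PosDef) (t : ℝ) :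
    mpow M t = NormedSpace.exp (t • mlog M) := by
  rw [mlog, mpow, dif_pos hM.1, dif_pos hM.1]
  have hmem := hM.1.eigenvectorUnitary.2
  have h1 := Unitary.mul_star_self_of_mem hmem
  have hpos := hM.eigenvalues_pos
  generalize (hM.1.eigenvectorUnitary : Matrix (Fin d) (Fin d) ℝ) = U at *
  have hinv : star U = U⁻¹ := (Matrix.inv_eq_right_inv h1).symm
  have hU : IsUnit U := IsUnit.of_mul_eq_one _ h1
  rw [hinv, ← Matrix.smul_mul, ← Matrix.mul_smul, Matrix.exp_conj _ _ hU, ← Matrix.diagonal_smul,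
    Matrix.exp_diagonal]
  congr 3
  funext i
  rw [Pi.coe_exp, ← Real.exp_eq_exp_ℝ, Real.rpow_def_of_pos (hpos i)]
  simp [mul_comm]

lemma mpow_one' {d : ℕ} {M : Matrix (Fin d) (Fin d) ℝ} (hM : M.PosDef) : mpow M 1 = M := by
  rw [mpow, dif_pos hM.1]
  conv_rhs => rw [hM.1.spectral_theorem]
  simp [Unitary.conjStarAlgAut_apply]

open scoped Matrix.Norms.L2Operator in
lemma exp_inj_symm {d : ℕ} {A B : Matrix (Fin d) (Fin d) ℝ} (hA : Aᵀ = A) (hB : Bᵀ = B)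
    (h : NormedSpace.exp A = NormedSpace.exp B) : A = B := by
  have hA' : IsSelfAdjoint A := by
    rw [IsSelfAdjoint, star_eq_conjTranspose, conjTranspose_eq_transpose_of_trivial, hA]
  have hB' : IsSelfAdjoint B := by
    rw [IsSelfAdjoint, star_eq_conjTranspose, conjTranspose_eq_transpose_of_trivial, hB]
  rw [← CFC.log_exp A hA', ← CFC.log_exp B hB']
  exact congrArg _ h

theorem stmt_10 {d : ℕ} (hd : 1 ≤ d) (p q : Matrix (Fin d) (Fin d) ℝ)
    (hp : p.PosDef) (hq : q.PosDef) :
    ∀ h : Matrix (Fin d) (Fin d) ℝ,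
      h = mpow p (1/2) * mlog ((mpow p (1/2))⁻¹ * q * (mpow p (1/2))⁻¹) * mpow p (1/2) →
        h.IsSymm ∧
        (∀ t ∈ Set.Icc (0 : ℝ) 1, geo p q t = p * mexp (t • (p⁻¹ * h))) ∧
        (p * mexp (p⁻¹ * h) = q ∧
          ∀ h' : Matrix (Fin d) (Fin d) ℝ, h'.IsSymm → p * mexp (p⁻¹ * h') = q → h' = h) := by
  intro h hh
  have hs := mpow_eq hp (1/2)
  have hss : mpow p (1/2) * mpow p (1/2) = p := by
    conv_rhs => rw [← mpow_one' hp, mpow_eq hp]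
    rw [hs, ← Matrix.exp_add_of_commute _ _ (Commute.refl _), ← add_smul]
    norm_num
  have hsT : (mpow p (1/2))ᵀ = mpow p (1/2) := by
    rw [hs, ← Matrix.exp_transpose, Matrix.transpose_smul, mlog_symm hp]
  have hsU : IsUnit (mpow p (1/2)) := by rw [hs]; exact Matrix.isUnit_exp _
  simp only [geo, mexp_eq]
  clear hs
  generalize mpow p (1/2) = s at *
  have hdet : IsUnit s.det := (Matrix.isUnit_iff_isUnit_det s).1 hsU
  have e1 : s⁻¹ * s = 1 := Matrix.nonsing_inv_mul s hdet
  have e2 : s * s⁻¹ = 1 := Matrix.mul_nonsing_inv s hdet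
  have hiT : (s⁻¹)ᵀ = s⁻¹ := by rw [Matrix.transpose_nonsing_inv, hsT]
  have hM : (s⁻¹ * q * s⁻¹).PosDef := by
    have := (Matrix.IsUnit.posDef_star_left_conjugate_iff (x := q)
      (IsUnit.of_mul_eq_one _ e1 : IsUnit s⁻¹)).2 hq
    rwa [star_eq_conjTranspose, conjTranspose_eq_transpose_of_trivial, hiT] at this
  have hLT := mlog_symm hM
  have hpow := mpow_eq hM
  have hone := mpow_one' hM
  rw [hpow, one_smul] at hone
  have key : ∀ X : Matrix (Fin d) (Fin d) ℝ,
      p * NormedSpace.exp (p⁻¹ * (s * X * s)) = s * NormedSpace.exp X * s := by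
    intro X
    have : p⁻¹ * (s * X * s) = s⁻¹ * X * s := by
      rw [← hss, Matrix.mul_inv_rev]
      calc s⁻¹ * s⁻¹ * (s * X * s) = s⁻¹ * (s⁻¹ * s) * X * s := by simp only [Matrix.mul_assoc]
        _ = _ := by rw [e1, Matrix.mul_one]
    rw [this, Matrix.exp_conj' _ _ hsU, ← hss]
    calc s * s * (s⁻¹ * NormedSpace.exp X * s) = s * (s * s⁻¹) * NormedSpace.exp X * s := by
          simp only [Matrix.mul_assoc]
      _ = _ := by rw [e2, Matrix.mul_one]
  have back : ∀ Y : Matrix (Fin d) (Fin d) ℝ, s * (s⁻¹ * Y * s⁻¹) * s = Y := by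
    intro Y
    calc s * (s⁻¹ * Y * s⁻¹) * s = (s * s⁻¹) * Y * (s⁻¹ * s) := by simp only [Matrix.mul_assoc]
      _ = Y := by rw [e1, e2, Matrix.one_mul, Matrix.mul_one]
  refine ⟨?_, ?_, ?_, ?_⟩
  · rw [hh, Matrix.IsSymm, Matrix.transpose_mul, Matrix.transpose_mul, hLT, hsT, ← Matrix.mul_assoc s]
  · intro t _
    rw [hpow, ← key, hh]
    simp only [Matrix.mul_smul, Matrix.smul_mul]
  · rw [hh, key, hone, back]
  · intro h' hS he
    rw [← back h', key] at he
    have he2 : NormedSpace.exp (s⁻¹ * h' * s⁻¹) = s⁻¹ * q * s⁻¹ := by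
      rw [← he]
      generalize NormedSpace.exp (s⁻¹ * h' * s⁻¹) = Z
      calc Z = (s⁻¹ * s) * Z * (s * s⁻¹) := by rw [e1, e2, Matrix.one_mul, Matrix.mul_one]
        _ = _ := by simp only [Matrix.mul_assoc]
    have hXT : (s⁻¹ * h' * s⁻¹)ᵀ = s⁻¹ * h' * s⁻¹ := by
      rw [Matrix.transpose_mul, Matrix.transpose_mul, hiT, hS.eq, Matrix.mul_assoc]
    rw [hh, ← exp_inj_symm hXT hLT (he2.trans hone.symm), back]
end

section
/- For every A ∈ GL(d,ℝ) and all p₀, p₁, q₀, q₁ ∈ S⁺_d, the following majorization inequality holds: σ⃗((q₀ #_{1/2} q₁)^{1/2} · A · (p₀ #_{1/2} p₁)^{−1/2}) ⪯ ½ σ⃗(q₀^{1/2} A p₀^{−1/2}) + ½ σ⃗(q₁^{1/2} A p₁^{−1/2}). -/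
open Matrix Polynomial

theorem cb_aux {d k : ℕ} (l : Fin d → ℝ) (Y : Matrix (Fin d) (Fin k) ℝ) :
    (Yᵀ * diagonal l * Y).det =
      ∑ f : Fin k → Fin d, (∏ i, l (f i)) * (∏ i, Y (f i) i) * (Y.submatrix f id).det := by
  have h : ∀ f : Fin k → Fin d, (Y.submatrix f id).det
      = ∑ s : Equiv.Perm (Fin k), ((Equiv.Perm.sign s : ℤ) : ℝ) * ∏ i, Y (f i) (s i) := by
    intro f
    rw [← det_transpose, det_apply']
    simp
  simp only [h, Finset.mul_sum]
  rw [Finset.sum_comm, det_apply']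
  refine Finset.sum_congr rfl fun s _ => ?_
  have : ∀ i j, (Yᵀ * diagonal l * Y) i j = ∑ a, Y a i * l a * Y a j := by
    intro i j
    rw [mul_apply]
    simp only [mul_diagonal, transpose_apply]
  simp only [this]
  rw [Finset.prod_univ_sum, Finset.mul_sum, Fintype.piFinset_univ]
  refine Finset.sum_congr rfl fun f _ => ?_
  simp only [Finset.prod_mul_distrib]
  ring

theorem cb {d k : ℕ} (l : Fin d → ℝ) (Y : Matrix (Fin d) (Fin k) ℝ) :
    (k.factorial : ℝ) * (Yᵀ * diagonal l * Y).det =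
      ∑ f : Fin k → Fin d, (∏ i, l (f i)) * (Y.submatrix f id).det ^ 2 := by
  have h1 : ∀ s : Equiv.Perm (Fin k), (Yᵀ * diagonal l * Y).det =
      ∑ f : Fin k → Fin d, (∏ i, l (f i)) *
        (((Equiv.Perm.sign s : ℤ) : ℝ) * ∏ i, Y (f (s i)) i) * (Y.submatrix f id).det := by
    intro s
    rw [cb_aux]
    symm
    refine Fintype.sum_equiv (Equiv.arrowCongr s.symm (Equiv.refl _)) _ _ fun f => ?_
    have e : (Equiv.arrowCongr s.symm (Equiv.refl (Fin d))) f = f ∘ s := by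
      ext; simp [Equiv.arrowCongr]
    rw [e]
    have e2 : (Y.submatrix (f ∘ s) id).det
        = ((Equiv.Perm.sign s : ℤ) : ℝ) * (Y.submatrix f id).det := by
      rw [← det_permute]; simp
    have e3 : ∏ i, l ((f ∘ s) i) = ∏ i, l (f i) := Equiv.prod_comp s (fun i => l (f i))
    rw [e2, e3]
    simp only [Function.comp]
    ring
  have h2 : (k.factorial : ℝ) * (Yᵀ * diagonal l * Y).det =
      ∑ s : Equiv.Perm (Fin k), (Yᵀ * diagonal l * Y).det := by
    simp [Fintype.card_perm]
  rw [h2, Finset.sum_congr rfl fun s _ => h1 s, Finset.sum_comm]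
  refine Finset.sum_congr rfl fun f _ => ?_
  rw [← Finset.sum_mul, ← Finset.mul_sum, pow_two, mul_assoc]
  congr 2
  rw [det_apply']
  simp

theorem prod_top {d k : ℕ} (hk : k ≤ d) (l : Fin d → ℝ) (hl : Antitone l) (h0 : ∀ i, 0 ≤ l i)
    (f : Fin k → Fin d) (hf : Function.Injective f) :
    ∏ i, l (f i) ≤ ∏ i, l (Fin.castLE hk i) := by
  set s := Finset.univ.image f with hs
  have hc : s.card = k := by simp [hs, Finset.card_image_of_injective _ hf]
  have e1 : ∏ i, l (f i) = ∏ j ∈ s, l j := by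
    rw [hs, Finset.prod_image (fun a _ b _ h => hf h)]
  rw [e1, ← Finset.map_orderEmbOfFin_univ s hc, Finset.prod_map]
  refine Finset.prod_le_prod (fun i _ => h0 _) fun i _ => hl ?_
  have hm : StrictMono (fun i : Fin k => ((s.orderEmbOfFin hc i : Fin d) : ℕ)) :=
    fun a b h => (s.orderEmbOfFin hc).strictMono h
  rw [Fin.le_def]
  obtain ⟨i, hi⟩ := i
  simp only [Fin.val_castLE]
  induction i with
  | zero => exact Nat.zero_le _
  | succ n ih =>
    have := ih (by omega)
    have h3 := @hm ⟨n, by omega⟩ ⟨n+1, hi⟩ (by simp [Fin.lt_def])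
    simp only at h3
    exact lt_of_le_of_lt (this (Finset.mem_univ _)) h3

theorem det_le_diag {d k : ℕ} (hk : k ≤ d) (l : Fin d → ℝ) (hl : Antitone l) (h0 : ∀ i, 0 ≤ l i)
    (Y : Matrix (Fin d) (Fin k) ℝ) :
    (Yᵀ * diagonal l * Y).det ≤ (∏ i, l (Fin.castLE hk i)) * (Yᵀ * Y).det := by
  have hf : (0 : ℝ) < k.factorial := by exact_mod_cast k.factorial_pos
  refine le_of_mul_le_mul_left ?_ hf
  have h1 := cb (fun _ => (1:ℝ)) Y
  simp only [diagonal_one, Matrix.mul_one, Finset.prod_const_one, one_mul] at h1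
  rw [cb, mul_left_comm, h1, Finset.mul_sum]
  refine Finset.sum_le_sum fun f _ => ?_
  by_cases hi : Function.Injective f
  · exact mul_le_mul_of_nonneg_right (prod_top hk l hl h0 f hi) (sq_nonneg _)
  · have : (Y.submatrix f id).det = 0 := by
      simp only [Function.Injective, not_forall] at hi
      obtain ⟨a, b, hab, hne⟩ := hi
      exact det_zero_of_row_eq hne (by ext; simp [hab])
    simp [this]

theorem herm_spec {d : ℕ} (p : Matrix (Fin d) (Fin d) ℝ) (h : p.IsHermitian) :
    (h.eigenvectorUnitary : Matrix (Fin d) (Fin d) ℝ)ᵀ * h.eigenvectorUnitary = 1 ∧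
    p = h.eigenvectorUnitary * diagonal h.eigenvalues *
      (h.eigenvectorUnitary : Matrix (Fin d) (Fin d) ℝ)ᵀ := by
  constructor
  · have := Unitary.coe_star_mul_self h.eigenvectorUnitary
    simpa [star_eq_conjTranspose] using this
  · have := h.spectral_theorem
    rw [Unitary.conjStarAlgAut_apply] at this
    simpa [star_eq_conjTranspose, Function.comp_def] using this

theorem sv_spec {d : ℕ} (W : Matrix (Fin d) (Fin d) ℝ) :
    Antitone (singularValues W) ∧ (∀ i, 0 ≤ singularValues W i) ∧
    ∃ Q : Matrix (Fin d) (Fin d) ℝ, Qᵀ * Q = 1 ∧ Q * Qᵀ = 1 ∧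
      Wᵀ * W = Q * diagonal (fun i => singularValues W i ^ 2) * Qᵀ := by
  set h := Matrix.isHermitian_conjTranspose_mul_self W with hh
  set g : Fin d → ℝ := fun j => Real.sqrt (h.eigenvalues j) with hg
  have hsv : ∀ i, singularValues W i = g (Tuple.sort g i.rev) := fun i => rfl
  refine ⟨?_, fun i => Real.sqrt_nonneg _, ?_⟩
  · intro i j hij
    rw [hsv, hsv]
    exact Tuple.monotone_sort g (Fin.rev_le_rev.2 hij)
  · set e : Equiv.Perm (Fin d) := Fin.revPerm.trans (Tuple.sort g) with he
    set Q := (h.eigenvectorUnitary : Matrix (Fin d) (Fin d) ℝ) with hQ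
    have q1 : Qᵀ * Q = 1 := (herm_spec _ h).1
    have q2 : Q * Qᵀ = 1 := mul_eq_one_comm.1 q1
    have hs : (fun i => singularValues W i ^ 2) = h.eigenvalues ∘ e := by
      funext i
      rw [hsv]
      simp only [hg]
      rw [Real.sq_sqrt ((posSemidef_conjTranspose_mul_self W).eigenvalues_nonneg _)]
      rfl
    have sp : Wᵀ * W = Q * diagonal h.eigenvalues * Qᵀ := (herm_spec _ h).2
    refine ⟨Q.submatrix id e, ?_, ?_, ?_⟩
    · rw [transpose_submatrix, submatrix_mul _ _ e id e Function.bijective_id |>.symm, q1]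
      simp
    · rw [transpose_submatrix, submatrix_mul _ _ id e id e.bijective |>.symm, q2]
      simp
    · rw [hs, ← submatrix_diagonal _ e e.injective, transpose_submatrix,
       submatrix_mul _ _ id e e e.bijective |>.symm, submatrix_mul _ _ id e id e.bijective |>.symm]
      simpa using sp

theorem det_le_sv {d k : ℕ} (hk : k ≤ d) (W : Matrix (Fin d) (Fin d) ℝ)
    (Z : Matrix (Fin d) (Fin k) ℝ) :
    ((W * Z)ᵀ * (W * Z)).det ≤ (∏ i, singularValues W (Fin.castLE hk i)) ^ 2 * (Zᵀ * Z).det := by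
  obtain ⟨ha, h0, Q, q1, q2, hW⟩ := sv_spec W
  have := det_le_diag hk (fun i => singularValues W i ^ 2)
    (fun i j h => pow_le_pow_left₀ (h0 _) (ha h) 2) (fun i => sq_nonneg _) (Qᵀ * Z)
  rw [← Finset.prod_pow]
  have e1 : (W * Z)ᵀ * (W * Z) = (Qᵀ * Z)ᵀ * diagonal (fun i => singularValues W i ^ 2) * (Qᵀ * Z) := by
    rw [transpose_mul, transpose_mul, transpose_transpose, Matrix.mul_assoc, ← Matrix.mul_assoc Wᵀ,
      hW]
    simp only [Matrix.mul_assoc]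
  have e2 : (Qᵀ * Z)ᵀ * (Qᵀ * Z) = Zᵀ * Z := by
    rw [transpose_mul, transpose_transpose, Matrix.mul_assoc, ← Matrix.mul_assoc Q, q2,
      Matrix.one_mul]
  rw [e1, ← e2]
  exact this

theorem sv_det {d : ℕ} (W : Matrix (Fin d) (Fin d) ℝ) :
    ∏ i, singularValues W i = |W.det| := by
  obtain ⟨ha, h0, Q, q1, q2, hW⟩ := sv_spec W
  have := congrArg det hW
  rw [det_mul_right_comm, q2, Matrix.one_mul, det_diagonal, det_mul, det_transpose,
    Finset.prod_pow, ← pow_two] at this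
  rw [← Real.sqrt_sq_eq_abs, this, Real.sqrt_sq (Finset.prod_nonneg fun i _ => h0 i)]

theorem sv_pos {d : ℕ} (W : Matrix (Fin d) (Fin d) ℝ) (h : W.det ≠ 0) (i : Fin d) :
    0 < singularValues W i := by
  refine lt_of_le_of_ne ((sv_spec W).2.1 i) fun h0 => ?_
  have := sv_det W
  rw [Finset.prod_eq_zero (Finset.mem_univ i) h0.symm] at this
  exact h (abs_eq_zero.1 this.symm)

theorem sv_congr {d : ℕ} (W V : Matrix (Fin d) (Fin d) ℝ)
    (h : (Wᵀ * W).charpoly = (Vᵀ * V).charpoly) : singularValues W = singularValues V := by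
  have := (IsHermitian.eigenvalues_eq_eigenvalues_iff (isHermitian_conjTranspose_mul_self W)
    (isHermitian_conjTranspose_mul_self V)).2 (by simpa using h)
  unfold singularValues
  rw [this]

theorem sv_orth {d : ℕ} (W U V : Matrix (Fin d) (Fin d) ℝ) (hU : Uᵀ * U = 1) (hV : Vᵀ * V = 1) :
    singularValues (Vᵀ * Wᵀ * U) = singularValues W := by
  have hU' := mul_eq_one_comm.1 hU
  have hV' := mul_eq_one_comm.1 hV
  apply sv_congr
  have : (Vᵀ * Wᵀ * U)ᵀ * (Vᵀ * Wᵀ * U) = (Uᵀ * W) * ((V * Vᵀ) * Wᵀ * U) := by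
    simp [Matrix.mul_assoc]
  rw [this, hV', charpoly_mul_comm, Matrix.one_mul]
  have : Wᵀ * U * (Uᵀ * W) = Wᵀ * (U * Uᵀ) * W := by simp [Matrix.mul_assoc]
  rw [this, hU', Matrix.mul_one]

theorem core {d k : ℕ} (hk : k ≤ d) (W S T R : Matrix (Fin d) (Fin d) ℝ) (hR : R.det ≠ 0)
    (h : S * T * R = R * (Wᵀ * W)) :
    (∏ i, singularValues W (Fin.castLE hk i)) ^ 2 ≤
      (∏ i, singularValues S (Fin.castLE hk i)) * (∏ i, singularValues T (Fin.castLE hk i)) := by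
  have hS := det_le_sv hk S
  have hT := det_le_sv hk T
  obtain ⟨ha, h0, Q, q1, q2, hW⟩ := sv_spec W
  set l : Fin k → ℝ := fun i => singularValues W (Fin.castLE hk i) ^ 2 with hl
  set Z : Matrix (Fin d) (Fin k) ℝ := (R * Q).submatrix id (Fin.castLE hk) with hZ
  have key : S * (T * Z) = Z * diagonal l := by
    have h1 : S * T * (R * Q) = (R * Q) * diagonal (fun i => singularValues W i ^ 2) := by
      rw [← Matrix.mul_assoc, h, hW]
      simp only [Matrix.mul_assoc, q1, Matrix.mul_one]
    ext i j
    have h2 := congrFun (congrFun h1 i) (Fin.castLE hk j)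
    rw [mul_diagonal] at h2
    rw [← Matrix.mul_assoc, mul_diagonal]
    exact h2
  have hQ : Q.det ≠ 0 := by
    intro h; have := congrArg det q1; simp [h] at this
  have hpos : 0 < (Zᵀ * Z).det := by
    have : (Zᴴ * Z).PosDef := by
      apply PosDef.conjTranspose_mul_self
      have hu : IsUnit (R * Q) := by
        rw [isUnit_iff_isUnit_det, det_mul]; exact (mul_ne_zero hR hQ).isUnit
      have hli := (linearIndependent_cols_iff_isUnit.2 hu).comp _ (Fin.castLE_injective hk)
      rw [mulVec_injective_iff]
      exact hli
    simpa using this.det_pos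
  have e1 : ((S * (T * Z))ᵀ * (S * (T * Z))).det = (∏ i, l i) ^ 2 * (Zᵀ * Z).det := by
    rw [key, transpose_mul, diagonal_transpose, Matrix.mul_assoc, ← Matrix.mul_assoc Zᵀ, det_mul,
      det_mul, det_diagonal]
    ring
  have h3 := hS (T * Z)
  rw [e1] at h3
  have h4 := h3.trans (mul_le_mul_of_nonneg_left (hT Z) (sq_nonneg _))
  rw [← mul_assoc, ← mul_pow] at h4
  have h5 := le_of_mul_le_mul_right h4 hpos
  have h6 := (sq_le_sq₀ (Finset.prod_nonneg fun i _ => sq_nonneg _)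
    (mul_nonneg (Finset.prod_nonneg fun i _ => (sv_spec S).2.1 _)
     (Finset.prod_nonneg fun i _ => (sv_spec T).2.1 _))).1 h5
  rwa [hl, Finset.prod_pow] at h6

theorem sum_filter_log {d k : ℕ} (hk : k ≤ d) (x : Fin d → ℝ) :
    ∑ i ∈ Finset.univ.filter (fun i : Fin d => (i : ℕ) < k), x i
      = ∑ i : Fin k, x (Fin.castLE hk i) := by
  symm
  refine Finset.sum_bij (fun i _ => Fin.castLE hk i) (by simp)
    (fun a _ b _ h => Fin.castLE_injective hk h) ?_ (fun _ _ => rfl)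
  intro b hb
  simp only [Finset.mem_filter, Finset.mem_univ, true_and] at hb
  exact ⟨⟨b, hb⟩, by simp, rfl⟩

theorem mpow_half {d : ℕ} (p : Matrix (Fin d) (Fin d) ℝ) (hp : p.PosDef) :
    (mpow p (1/2))ᵀ = mpow p (1/2) ∧ mpow p (1/2) * mpow p (1/2) = p ∧
      (mpow p (1/2)).det ≠ 0 := by
  have h := hp.isHermitian
  set Q := (h.eigenvectorUnitary : Matrix (Fin d) (Fin d) ℝ) with hQ
  have hm : mpow p (1/2) = Q * diagonal (fun i => (h.eigenvalues i) ^ (1/2 : ℝ)) * Qᵀ := by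
    unfold mpow; rw [dif_pos h]; simp [star_eq_conjTranspose, hQ]
  have q1 : Qᵀ * Q = 1 := by
    have := Unitary.coe_star_mul_self h.eigenvectorUnitary
    simpa [star_eq_conjTranspose] using this
  have sp : p = Q * diagonal h.eigenvalues * Qᵀ := by
    have := h.spectral_theorem
    rw [Unitary.conjStarAlgAut_apply] at this
    simpa [star_eq_conjTranspose, Function.comp_def] using this
  have hsq : mpow p (1/2) * mpow p (1/2) = p := by
    have : mpow p (1/2) * mpow p (1/2) = Q * (diagonal (fun i => (h.eigenvalues i) ^ (1/2 : ℝ)) *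
       (Qᵀ * Q) * diagonal (fun i => (h.eigenvalues i) ^ (1/2 : ℝ))) * Qᵀ := by
      rw [hm]; simp only [Matrix.mul_assoc]
    rw [this, q1, Matrix.mul_one, diagonal_mul_diagonal]
    conv_rhs => rw [sp]
    congr 3
    funext i
    rw [← Real.rpow_add (hp.eigenvalues_pos i)]
    norm_num
  refine ⟨?_, hsq, ?_⟩
  · rw [hm]; simp [Matrix.mul_assoc]
  · intro h0
    have := congrArg det hsq
    rw [det_mul, h0, zero_mul] at this
    exact hp.det_pos.ne this

theorem posDef_conj {d : ℕ} (p R : Matrix (Fin d) (Fin d) ℝ) (hp : p.PosDef) (hR : R.det ≠ 0)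
    (hs : Rᵀ = R) : (R * p * R).PosDef := by
  have := hp.conjTranspose_mul_mul_same (B := R) (by
    rw [mulVec_injective_iff_isUnit, isUnit_iff_isUnit_det]; exact hR.isUnit)
  simpa [hs] using this

theorem mpow_half_posDef {d : ℕ} (p : Matrix (Fin d) (Fin d) ℝ) (hp : p.PosDef) :
    (mpow p (1/2)).PosDef := by
  have h := hp.isHermitian
  have hm : mpow p (1/2) = (h.eigenvectorUnitary : Matrix (Fin d) (Fin d) ℝ) *
      Matrix.diagonal (fun i => (h.eigenvalues i) ^ (1/2 : ℝ)) *
      star (h.eigenvectorUnitary : Matrix (Fin d) (Fin d) ℝ) := by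
    unfold mpow; rw [dif_pos h]
  rw [hm]
  have hd : (Matrix.diagonal (fun i => (h.eigenvalues i) ^ (1/2 : ℝ))).PosDef :=
    PosDef.diagonal fun i => Real.rpow_pos_of_pos (hp.eigenvalues_pos i) _
  refine hd.mul_mul_conjTranspose_same ?_
  rw [vecMul_injective_iff_isUnit]
  exact Unitary.isUnit_coe

theorem geo_spec {d : ℕ} (a b : Matrix (Fin d) (Fin d) ℝ) (ha : a.PosDef) (hb : b.PosDef) :
    (geo a b (1/2)).PosDef ∧ ∃ U : Matrix (Fin d) (Fin d) ℝ, Uᵀ * U = 1 ∧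
      geo a b (1/2) = mpow a (1/2) * U * mpow b (1/2) := by
  obtain ⟨a1, a2, a3⟩ := mpow_half a ha
  obtain ⟨b1, b2, b3⟩ := mpow_half b hb
  unfold geo
  set P := mpow a (1/2)
  set B := mpow b (1/2)
  have hPi : (P⁻¹)ᵀ = P⁻¹ := by rw [transpose_nonsing_inv, a1]
  have hBi : (B⁻¹)ᵀ = B⁻¹ := by rw [transpose_nonsing_inv, b1]
  have hPu : IsUnit P.det := a3.isUnit
  have hBu : IsUnit B.det := b3.isUnit
  have hC : (P⁻¹ * b * P⁻¹).PosDef := posDef_conj b _ hb (by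
    rw [det_nonsing_inv]; simpa using a3) hPi
  obtain ⟨c1, c2, c3⟩ := mpow_half _ hC
  have hCp := mpow_half_posDef _ hC
  set C := mpow (P⁻¹ * b * P⁻¹) (1/2)
  refine ⟨posDef_conj C P hCp a3 a1, C * P * B⁻¹, ?_, ?_⟩
  · have : (C * P * B⁻¹)ᵀ * (C * P * B⁻¹) = B⁻¹ * (P * (C * C) * P) * B⁻¹ := by
      simp only [transpose_mul, hBi, a1, c1, Matrix.mul_assoc]
    rw [this, c2]
    have : P * (P⁻¹ * b * P⁻¹) * P = (P * P⁻¹) * b * (P⁻¹ * P) := by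
      simp only [Matrix.mul_assoc]
    rw [this, mul_nonsing_inv _ hPu, nonsing_inv_mul _ hPu, Matrix.one_mul, Matrix.mul_one, ← b2,
      ← Matrix.mul_assoc, nonsing_inv_mul _ hBu, Matrix.one_mul, mul_nonsing_inv _ hBu]
  · simp only [Matrix.mul_assoc, nonsing_inv_mul _ hBu, Matrix.mul_one]

/-- For every `A ∈ GL(d,ℝ)` and all `p₀, p₁, q₀, q₁ ∈ S⁺_d`:
`σ⃗((q₀ #_{1/2} q₁)^{1/2} A (p₀ #_{1/2} p₁)^{−1/2}) ⪯
  ½ σ⃗(q₀^{1/2} A p₀^{−1/2}) + ½ σ⃗(q₁^{1/2} A p₁^{−1/2})`. -/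
theorem stmt_13 {d : ℕ} (hd : 1 ≤ d) (A p₀ p₁ q₀ q₁ : Matrix (Fin d) (Fin d) ℝ)
    (hA : IsUnit A) (hp₀ : p₀.PosDef) (hp₁ : p₁.PosDef)
    (hq₀ : q₀.PosDef) (hq₁ : q₁.PosDef) :
    Majorizes
      (logSV (mpow (geo q₀ q₁ (1/2)) (1/2) * A * (mpow (geo p₀ p₁ (1/2)) (1/2))⁻¹))
      (fun i =>
        (1/2) * logSV (mpow q₀ (1/2) * A * (mpow p₀ (1/2))⁻¹) i +
        (1/2) * logSV (mpow q₁ (1/2) * A * (mpow p₁ (1/2))⁻¹) i) := by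
  obtain ⟨a1, a2, a3⟩ := mpow_half p₀ hp₀
  obtain ⟨b1, b2, b3⟩ := mpow_half p₁ hp₁
  obtain ⟨c1, c2, c3⟩ := mpow_half q₀ hq₀
  obtain ⟨e1, e2, e3⟩ := mpow_half q₁ hq₁
  obtain ⟨hp, V, hV, hpV⟩ := geo_spec p₀ p₁ hp₀ hp₁
  obtain ⟨hq, U, hU, hqU⟩ := geo_spec q₀ q₁ hq₀ hq₁
  obtain ⟨f1, f2, f3⟩ := mpow_half _ hp
  obtain ⟨g1, g2, g3⟩ := mpow_half _ hq
  have hAd : A.det ≠ 0 := ((isUnit_iff_isUnit_det A).1 hA).ne_zero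
  set p := geo p₀ p₁ (1/2)
  set q := geo q₀ q₁ (1/2)
  set P := mpow p (1/2)
  set Q := mpow q (1/2)
  set P₀ := mpow p₀ (1/2)
  set P₁ := mpow p₁ (1/2)
  set Q₀ := mpow q₀ (1/2)
  set Q₁ := mpow q₁ (1/2)
  have hPi : (P⁻¹)ᵀ = P⁻¹ := by rw [transpose_nonsing_inv, f1]
  have hP0i : (P₀⁻¹)ᵀ = P₀⁻¹ := by rw [transpose_nonsing_inv, a1]
  have hinv : ∀ M : Matrix (Fin d) (Fin d) ℝ, M.det ≠ 0 → M⁻¹.det ≠ 0 := by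
    intro M hM
    rw [det_nonsing_inv]; simpa using hM
  have hV' : V⁻¹ = Vᵀ := inv_eq_left_inv hV
  have hpinv : P⁻¹ * P⁻¹ = P₁⁻¹ * Vᵀ * P₀⁻¹ := by
    rw [← Matrix.mul_inv_rev, f2, hpV, Matrix.mul_inv_rev, Matrix.mul_inv_rev, hV', Matrix.mul_assoc]
  set W := Q * A * P⁻¹ with hW
  set W₀ := Q₀ * A * P₀⁻¹ with hW₀
  set W₁ := Q₁ * A * P₁⁻¹ with hW₁
  have dW : W.det ≠ 0 := by
    rw [hW, det_mul, det_mul]; exact mul_ne_zero (mul_ne_zero g3 hAd) (hinv _ f3)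
  have dW₀ : W₀.det ≠ 0 := by
    rw [hW₀, det_mul, det_mul]; exact mul_ne_zero (mul_ne_zero c3 hAd) (hinv _ a3)
  have dW₁ : W₁.det ≠ 0 := by
    rw [hW₁, det_mul, det_mul]; exact mul_ne_zero (mul_ne_zero e3 hAd) (hinv _ b3)
  have dR : (P₁ * P⁻¹).det ≠ 0 := by
    rw [det_mul]; exact mul_ne_zero b3 (hinv _ f3)
  have key : (Vᵀ * W₀ᵀ * U) * W₁ * (P₁ * P⁻¹) = (P₁ * P⁻¹) * (Wᵀ * W) := by
    have l1 : (Vᵀ * W₀ᵀ * U) * W₁ * (P₁ * P⁻¹)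
        = Vᵀ * P₀⁻¹ * Aᵀ * (Q₀ * U * Q₁) * A * (P₁⁻¹ * P₁) * P⁻¹ := by
      rw [hW₀, hW₁]
      simp only [transpose_mul, hP0i, c1, Matrix.mul_assoc]
    have l2 : (P₁ * P⁻¹) * (Wᵀ * W) = P₁ * (P⁻¹ * P⁻¹) * Aᵀ * (Q * Q) * A * P⁻¹ := by
      rw [hW]
      simp only [transpose_mul, hPi, g1, Matrix.mul_assoc]
    rw [l1, l2, hpinv, g2, ← hqU, nonsing_inv_mul _ b3.isUnit, Matrix.mul_one]
    simp only [← Matrix.mul_assoc]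
    rw [mul_nonsing_inv _ b3.isUnit, Matrix.one_mul]
  have hsv := sv_orth W₀ U V hU hV
  have part : ∀ k (hk : k ≤ d),
      2 * ∑ i : Fin k, logSV W (Fin.castLE hk i) ≤
        ∑ i : Fin k, logSV W₀ (Fin.castLE hk i) + ∑ i : Fin k, logSV W₁ (Fin.castLE hk i) := by
    intro k hk
    have h := core hk W _ W₁ _ dR key
    rw [hsv] at h
    have hp1 : 0 < ∏ i, singularValues W (Fin.castLE hk i) :=
      Finset.prod_pos fun i _ => sv_pos W dW _
    have hp2 : 0 < ∏ i, singularValues W₀ (Fin.castLE hk i) :=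
      Finset.prod_pos fun i _ => sv_pos W₀ dW₀ _
    have hp3 : 0 < ∏ i, singularValues W₁ (Fin.castLE hk i) :=
      Finset.prod_pos fun i _ => sv_pos W₁ dW₁ _
    have h2 := Real.log_le_log (by positivity) h
    rw [Real.log_pow, Real.log_mul hp2.ne' hp3.ne',
      Real.log_prod (fun i _ => (sv_pos W dW _).ne'),
      Real.log_prod (fun i _ => (sv_pos W₀ dW₀ _).ne'),
      Real.log_prod (fun i _ => (sv_pos W₁ dW₁ _).ne')] at h2
    exact_mod_cast h2
  have tot : ∀ M : Matrix (Fin d) (Fin d) ℝ, M.det ≠ 0 → ∑ i, logSV M i = Real.log |M.det| := by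
    intro M hM
    rw [← sv_det, Real.log_prod (fun i _ => (sv_pos M hM _).ne')]
    rfl
  refine ⟨fun k hk => ?_, ?_⟩
  · rw [sum_filter_log hk.le, sum_filter_log hk.le, Finset.sum_add_distrib, ← Finset.mul_sum,
      ← Finset.mul_sum]
    linarith [part k hk.le]
  · rw [Finset.sum_add_distrib, ← Finset.mul_sum, ← Finset.mul_sum, tot W dW, tot W₀ dW₀,
      tot W₁ dW₁]
    have h1 := congrArg det key
    rw [det_mul, det_mul (P₁ * P⁻¹), mul_comm, det_mul (Vᵀ * W₀ᵀ * U)] at h1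
    have h2 := mul_left_cancel₀ dR h1
    have h3 : |(Vᵀ * W₀ᵀ * U).det| = |W₀.det| := by
      rw [← sv_det, ← sv_det, hsv]
    have h4 : |W₀.det| * |W₁.det| = |W.det| * |W.det| := by
      rw [← h3, ← abs_mul, h2, det_mul, det_transpose, abs_mul]
    have h5 := congrArg Real.log h4
    rw [Real.log_mul (abs_ne_zero.2 dW₀) (abs_ne_zero.2 dW₁),
      Real.log_mul (abs_ne_zero.2 dW) (abs_ne_zero.2 dW)] at h5
    linarith
end

section
/- The square-root map p ↦ p^{1/2}, defined on the open subset S⁺_d of the space of real symmetric d×d matrices, is Fréchet differentiable at every p ∈ S⁺_d, and its derivative at p is the linear map sending a symmetric matrix h to L_p^{−1}(h), i.e. to the unique solution X of the equation p^{1/2} X + X p^{1/2} = h. -/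
open Matrix Polynomial

attribute [local instance] Matrix.normedAddCommGroup Matrix.normedSpace

lemma aux_sq {d : ℕ} {q : Matrix (Fin d) (Fin d) ℝ} (hq : q.PosSemidef) :
    mpow q (1/2) * mpow q (1/2) = q := by
  have h := hq.1
  have hs := h.spectral_theorem
  rw [Unitary.conjStarAlgAut_apply] at hs
  unfold mpow
  rw [dif_pos h]
  set U : Matrix (Fin d) (Fin d) ℝ := (h.eigenvectorUnitary : Matrix (Fin d) (Fin d) ℝ) with hU
  have hUU : star U * U = 1 := Unitary.coe_star_mul_self _
  have hD : Matrix.diagonal (fun i => (h.eigenvalues i) ^ (1/2 : ℝ)) *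
      Matrix.diagonal (fun i => (h.eigenvalues i) ^ (1/2 : ℝ)) =
      Matrix.diagonal h.eigenvalues := by
    rw [Matrix.diagonal_mul_diagonal]
    congr 1
    funext i
    rw [← Real.sqrt_eq_rpow]
    exact Real.mul_self_sqrt (hq.eigenvalues_nonneg i)
  calc _ = U * Matrix.diagonal (fun i => (h.eigenvalues i) ^ (1/2 : ℝ)) * (star U * U) *
      Matrix.diagonal (fun i => (h.eigenvalues i) ^ (1/2 : ℝ)) * star U := by
        simp only [mul_assoc]
    _ = U * (Matrix.diagonal (fun i => (h.eigenvalues i) ^ (1/2 : ℝ)) *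
      Matrix.diagonal (fun i => (h.eigenvalues i) ^ (1/2 : ℝ))) * star U := by
        rw [hUU]; simp only [mul_assoc, one_mul]
    _ = q := by
        rw [hD]; exact hs.symm

lemma aux_conj {d : ℕ} (U : Matrix (Fin d) (Fin d) ℝ) (v : Fin d → ℝ) (hv : 0 ≤ v) :
    (U * Matrix.diagonal v * star U).PosSemidef :=
  (Matrix.PosSemidef.diagonal hv).mul_mul_conjTranspose_same U

lemma aux_psd {d : ℕ} {q : Matrix (Fin d) (Fin d) ℝ} (hq : q.PosSemidef) :
    (mpow q (1/2)).PosSemidef := by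
  unfold mpow
  rw [dif_pos hq.1]
  exact aux_conj _ _ (fun i => Real.rpow_nonneg (hq.eigenvalues_nonneg i) _)

lemma aux_gap {d : ℕ} {s : Matrix (Fin d) (Fin d) ℝ} (hs : s.PosDef) :
    ∃ c : ℝ, 0 < c ∧ (s - c • (1 : Matrix (Fin d) (Fin d) ℝ)).PosSemidef := by
  obtain ⟨c, hc, hle⟩ : ∃ c : ℝ, 0 < c ∧ ∀ i, c ≤ hs.1.eigenvalues i := by
    rcases isEmpty_or_nonempty (Fin d) with he | he
    · exact ⟨1, one_pos, fun i => he.elim i⟩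
    · obtain ⟨i, hi⟩ := Finite.exists_min hs.1.eigenvalues
      exact ⟨_, hs.eigenvalues_pos i, hi⟩
  refine ⟨c, hc, ?_⟩
  have h := hs.1
  have hsp := h.spectral_theorem
  rw [Unitary.conjStarAlgAut_apply] at hsp
  have hUU : (h.eigenvectorUnitary : Matrix (Fin d) (Fin d) ℝ) *
    star (h.eigenvectorUnitary : Matrix (Fin d) (Fin d) ℝ) = 1 := Unitary.coe_mul_star_self _
  have := aux_conj (h.eigenvectorUnitary : Matrix (Fin d) (Fin d) ℝ)
    (fun i => h.eigenvalues i - c) (fun i => sub_nonneg.2 (hle i))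
  convert this using 1
  have hd : Matrix.diagonal (fun i => h.eigenvalues i - c) =
      Matrix.diagonal h.eigenvalues - c • (1 : Matrix (Fin d) (Fin d) ℝ) := by
    rw [← Matrix.diagonal_one, ← Matrix.diagonal_smul, Matrix.diagonal_sub]
    congr 1
    funext i
    simp
  rw [hd, mul_sub, sub_mul, mul_smul_comm, mul_one, smul_mul_assoc, hUU]
  congr 1

lemma aux_key {d : ℕ} {s t e : Matrix (Fin d) (Fin d) ℝ} {c : ℝ}
    (hs : (s - c • (1 : Matrix (Fin d) (Fin d) ℝ)).PosSemidef) (ht : t.PosSemidef) :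
    c * ∑ i, ∑ j, e i j ^ 2 ≤ ∑ i, ∑ j, e i j * (s * e + e * t) i j := by
  have h1 := (hs.conjTranspose_mul_mul_same e).trace_nonneg
  have h2 := (ht.mul_mul_conjTranspose_same e).trace_nonneg
  have h3 : ∀ a b : Matrix (Fin d) (Fin d) ℝ, ∑ i, ∑ j, a i j * b i j = (aᴴ * b).trace := by
    intro a b
    simp only [Matrix.trace, Matrix.diag, Matrix.mul_apply, Matrix.conjTranspose_apply, star_trivial]
    exact Finset.sum_comm
  have h4 : ∑ i, ∑ j, e i j ^ 2 = (eᴴ * e).trace := by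
    rw [← h3]; simp only [sq]
  rw [h3, h4]
  rw [Matrix.mul_sub, Matrix.sub_mul, Matrix.trace_sub] at h1
  rw [Matrix.mul_smul, Matrix.mul_one, Matrix.smul_mul, Matrix.trace_smul, smul_eq_mul] at h1
  rw [Matrix.mul_add, Matrix.trace_add, ← Matrix.mul_assoc]
  rw [Matrix.trace_mul_comm] at h2
  linarith

lemma aux_near {d : ℕ} {p : Matrix (Fin d) (Fin d) ℝ} (hp : p.PosDef) :
    ∃ ε : ℝ, 0 < ε ∧ ∀ q : Matrix (Fin d) (Fin d) ℝ, q.IsSymm →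
      (∀ i j, |q i j - p i j| ≤ ε) → q.PosSemidef := by
  obtain ⟨c, hc, h⟩ := aux_gap hp
  refine ⟨c / (d + 1), by positivity, fun q hq hε => ?_⟩
  refine Matrix.PosSemidef.of_dotProduct_mulVec_nonneg (by
    rw [Matrix.IsHermitian, Matrix.conjTranspose_eq_transpose_of_trivial]; exact hq) fun x => ?_
  have h1 := h.dotProduct_mulVec_nonneg x
  simp only [star_trivial] at h1 ⊢
  rw [Matrix.sub_mulVec, dotProduct_sub, Matrix.smul_mulVec, Matrix.one_mulVec,
    dotProduct_smul, smul_eq_mul] at h1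
  have h2 : x ⬝ᵥ q *ᵥ x = x ⬝ᵥ p *ᵥ x + ∑ i, ∑ j, x i * ((q i j - p i j) * x j) := by
    simp only [dotProduct, Matrix.mulVec, Finset.mul_sum, ← Finset.sum_add_distrib]
    refine Finset.sum_congr rfl fun i _ => Finset.sum_congr rfl fun j _ => by ring
  have h3 : ∀ i j, -(c / (d + 1) * ((x i ^ 2 + x j ^ 2) / 2)) ≤ x i * ((q i j - p i j) * x j) := by
    intro i j
    have ha : |x i * ((q i j - p i j) * x j)| ≤ c / (d + 1) * ((x i ^ 2 + x j ^ 2) / 2) := by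
      calc |x i * ((q i j - p i j) * x j)| = |q i j - p i j| * (|x i| * |x j|) := by
            rw [abs_mul, abs_mul]; ring
        _ ≤ c / (d + 1) * ((x i ^ 2 + x j ^ 2) / 2) := by
            refine mul_le_mul (hε i j) ?_ (by positivity) (by positivity)
            nlinarith [sq_nonneg (|x i| - |x j|), sq_abs (x i), sq_abs (x j)]
    exact (abs_le.1 ha).1
  have h4 := Finset.sum_le_sum fun i (_ : i ∈ Finset.univ) =>
    Finset.sum_le_sum fun j (_ : j ∈ Finset.univ) => h3 i j
  have h5 : ∑ i, ∑ j, -(c / (d + 1) * ((x i ^ 2 + x j ^ 2) / 2)) =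
      -(c / (d + 1) * (d * (x ⬝ᵥ x))) := by
    have : x ⬝ᵥ x = ∑ i, x i ^ 2 := by simp only [dotProduct, sq]
    rw [this]
    simp only [Finset.sum_neg_distrib, ← Finset.mul_sum, ← Finset.sum_div, Finset.sum_add_distrib,
      Finset.sum_const, Finset.card_univ, Fintype.card_fin, nsmul_eq_mul]
    ring
  have h6 : 0 ≤ x ⬝ᵥ x := by
    simp only [dotProduct]
    exact Finset.sum_nonneg fun i _ => mul_self_nonneg _
  have h7 : c / (d + 1) * (d * (x ⬝ᵥ x)) ≤ c * (x ⬝ᵥ x) := by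
    rw [← mul_assoc]
    refine mul_le_mul_of_nonneg_right ?_ h6
    rw [div_mul_eq_mul_div, div_le_iff₀ (by positivity)]
    nlinarith
  linarith

lemma aux_pd {d : ℕ} {p : Matrix (Fin d) (Fin d) ℝ} (hp : p.PosDef) :
    (mpow p (1/2)).PosDef := by
  have h : (mpow p (1/2)).PosSemidef := aux_psd hp.posSemidef
  refine Matrix.PosDef.of_dotProduct_mulVec_pos h.1 fun x hx => ?_
  refine lt_of_le_of_ne (h.dotProduct_mulVec_nonneg x) fun h0 => ?_
  have h1 := (h.dotProduct_mulVec_zero_iff x).1 h0.symm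
  have h2 : p *ᵥ x = 0 := by
    rw [← aux_sq hp.posSemidef, ← Matrix.mulVec_mulVec, h1, Matrix.mulVec_zero]
  have := hp.dotProduct_mulVec_pos hx
  rw [h2] at this
  simp at this

lemma aux_dist {d : ℕ} {s t : Matrix (Fin d) (Fin d) ℝ} {c : ℝ} (hc : 0 < c)
    (hs : (s - c • (1 : Matrix (Fin d) (Fin d) ℝ)).PosSemidef) (ht : t.PosSemidef) :
    ∑ i, ∑ j, (t i j - s i j) ^ 2 ≤ (1 / c ^ 2) * ∑ i, ∑ j, ((t * t) i j - (s * s) i j) ^ 2 := by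
  have h := aux_key (e := t - s) hs ht
  have he : s * (t - s) + (t - s) * t = t * t - s * s := by noncomm_ring
  rw [he] at h
  have h2 : ∑ i, ∑ j, (t - s) i j * (t * t - s * s) i j ≤
      ∑ i, ∑ j, (c / 2 * (t - s) i j ^ 2 + 1 / (2 * c) * (t * t - s * s) i j ^ 2) := by
    refine Finset.sum_le_sum fun i _ => Finset.sum_le_sum fun j _ => ?_
    set a := (t - s) i j
    set b := (t * t - s * s) i j
    have : c / 2 * a ^ 2 + 1 / (2 * c) * b ^ 2 - a * b = (c * a - b) ^ 2 / (2 * c) := by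
      field_simp; ring
    have h' : 0 ≤ (c * a - b) ^ 2 / (2 * c) := by positivity
    linarith
  simp only [Finset.sum_add_distrib, ← Finset.mul_sum] at h2
  simp only [← Matrix.sub_apply]
  set A := ∑ i, ∑ j, (t - s) i j ^ 2
  set B := ∑ i, ∑ j, (t * t - s * s) i j ^ 2
  have h3 : c / 2 * A ≤ 1 / (2 * c) * B := by linarith
  have h4 := mul_le_mul_of_nonneg_left h3 (show 0 ≤ 2 / c by positivity)
  have e1 : 2 / c * (c / 2 * A) = A := by field_simp
  have e2 : 2 / c * (1 / (2 * c) * B) = 1 / c ^ 2 * B := by field_simp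
  rwa [e1, e2] at h4

open Filter Topology in
lemma aux_evt {d : ℕ} {p : Matrix (Fin d) (Fin d) ℝ} (hp : p.PosDef) :
    ∀ᶠ q in 𝓝[{A : Matrix (Fin d) (Fin d) ℝ | A.IsSymm}] p, q.PosSemidef := by
  obtain ⟨ε, hε, h⟩ := aux_near hp
  filter_upwards [self_mem_nhdsWithin, mem_nhdsWithin_of_mem_nhds (Metric.ball_mem_nhds p hε)]
    with q hq hb
  refine h q hq fun i j => ?_
  rw [Metric.mem_ball, dist_eq_norm] at hb
  exact ((Matrix.norm_entry_le_entrywise_sup_norm (q - p) (i := i) (j := j)).trans hb.le)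

open Filter Topology in
lemma aux_cont {d : ℕ} {p : Matrix (Fin d) (Fin d) ℝ} (hp : p.PosDef) :
    Tendsto (fun A => mpow A (1/2)) (𝓝[{A : Matrix (Fin d) (Fin d) ℝ | A.IsSymm}] p)
      (𝓝 (mpow p (1/2))) := by
  obtain ⟨c, hc, h⟩ := aux_gap (aux_pd hp)
  refine tendsto_pi_nhds.2 fun i => tendsto_pi_nhds.2 fun j => ?_
  have hlim : Tendsto (fun q : Matrix (Fin d) (Fin d) ℝ =>
      √((1 / c ^ 2) * ∑ i, ∑ j, (q i j - p i j) ^ 2))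
      (𝓝[{A : Matrix (Fin d) (Fin d) ℝ | A.IsSymm}] p) (𝓝 0) := by
    have hcont : Continuous (fun q : Matrix (Fin d) (Fin d) ℝ =>
      √((1 / c ^ 2) * ∑ i, ∑ j, (q i j - p i j) ^ 2)) := by
      fun_prop
    have := hcont.tendsto p
    simp only [sub_self] at this
    refine Tendsto.mono_left ?_ nhdsWithin_le_nhds
    simpa using this
  rw [tendsto_iff_dist_tendsto_zero]
  refine squeeze_zero' (Eventually.of_forall fun _ => dist_nonneg) ?_ hlim
  filter_upwards [aux_evt hp] with q hq
  have hd := aux_dist hc h (aux_psd hq)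
  rw [aux_sq hq, aux_sq hp.posSemidef] at hd
  rw [Real.dist_eq]
  refine Real.abs_le_sqrt (le_trans ?_ hd)
  refine le_trans ?_ (Finset.single_le_sum (f := fun i => ∑ j, (mpow q (1/2) i j - mpow p (1/2) i j) ^ 2)
    (fun i _ => Finset.sum_nonneg fun j _ => sq_nonneg _) (Finset.mem_univ i))
  exact Finset.single_le_sum (f := fun j => (mpow q (1/2) i j - mpow p (1/2) i j) ^ 2)
    (fun j _ => sq_nonneg _) (Finset.mem_univ j)

lemma aux_inj {d : ℕ} {s : Matrix (Fin d) (Fin d) ℝ} (hs : s.PosDef) :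
    Function.Injective (LinearMap.mulLeft ℝ s + LinearMap.mulRight ℝ s) := by
  rw [injective_iff_map_eq_zero]
  intro e he
  obtain ⟨c, hc, h⟩ := aux_gap hs
  have hk := aux_key (e := e) h hs.posSemidef
  simp only [LinearMap.add_apply, LinearMap.mulLeft_apply, LinearMap.mulRight_apply] at he
  rw [he] at hk
  simp only [Matrix.zero_apply, mul_zero, Finset.sum_const_zero] at hk
  have h0 : ∑ i, ∑ j, e i j ^ 2 ≤ 0 := by
    by_contra hcon
    push Not at hcon
    have := mul_pos hc hcon
    linarith
  ext i j
  have h1 : e i j ^ 2 ≤ ∑ i, ∑ j, e i j ^ 2 :=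
    le_trans (Finset.single_le_sum (f := fun j => e i j ^ 2)
      (fun j _ => sq_nonneg _) (Finset.mem_univ j))
      (Finset.single_le_sum (f := fun i => ∑ j, e i j ^ 2)
    (fun i _ => Finset.sum_nonneg fun j _ => sq_nonneg _) (Finset.mem_univ i))
  have h2 : e i j ^ 2 = 0 := le_antisymm (h1.trans h0) (sq_nonneg _)
  simpa using h2

/-- The square-root map `p ↦ p^{1/2}`, defined on the open subset `S⁺_d`
of the space of real symmetric `d×d` matrices, is Fréchet differentiable at every
`p ∈ S⁺_d`, and its derivative at `p` sends a symmetric matrix `h` to `L_p⁻¹(h)`, i.e. to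
the unique solution `X` of `p^{1/2} X + X p^{1/2} = h`. -/
theorem stmt_16 {d : ℕ} (hd : 1 ≤ d) (p : Matrix (Fin d) (Fin d) ℝ) (hp : p.PosDef) :
    ∃ L : Matrix (Fin d) (Fin d) ℝ →L[ℝ] Matrix (Fin d) (Fin d) ℝ,
      HasFDerivWithinAt (fun A => mpow A (1/2)) L {A : Matrix (Fin d) (Fin d) ℝ | A.IsSymm} p ∧
      ∀ h : Matrix (Fin d) (Fin d) ℝ, h.IsSymm →
        mpow p (1/2) * L h + L h * mpow p (1/2) = h := by
  have hs := aux_pd hp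
  set Λ : Matrix (Fin d) (Fin d) ℝ ≃L[ℝ] Matrix (Fin d) (Fin d) ℝ :=
    (LinearEquiv.ofInjectiveEndo _ (aux_inj hs)).toContinuousLinearEquiv with hΛ
  have hΛa : ∀ X, Λ X = mpow p (1/2) * X + X * mpow p (1/2) := fun X => rfl
  refine ⟨Λ.symm, ?_, fun h _ => ?_⟩
  · have hder : HasFDerivAt (fun A : Matrix (Fin d) (Fin d) ℝ => A * A)
        (Λ : Matrix (Fin d) (Fin d) ℝ →L[ℝ] Matrix (Fin d) (Fin d) ℝ) (mpow p (1/2)) := by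
      have := ((LinearMap.mul ℝ (Matrix (Fin d) (Fin d) ℝ)).toContinuousBilinearMap).hasFDerivAt_of_bilinear
        (hasFDerivAt_id (mpow p (1/2))) (hasFDerivAt_id (mpow p (1/2)))
      refine HasFDerivAt.congr_fderiv this ?_
      ext1 X
      exact (rfl : mpow p (1/2) * X + X * mpow p (1/2) = _)
    refine HasFDerivWithinAt.of_local_left_inverse (t := Set.univ) ?_ hder.hasFDerivWithinAt ?_ ?_
    · rw [nhdsWithin_univ]; exact aux_cont hp
    · have := hp.1
      rwa [Matrix.IsHermitian, Matrix.conjTranspose_eq_transpose_of_trivial] at this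
    · filter_upwards [aux_evt hp] with q hq using aux_sq hq
  · exact (hΛa _).symm.trans (Λ.apply_symm_apply h)
end
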